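/- Let y > 1 be a real number. Suppose there exists a constant C > 0 (possibly depending on y) such that for all integers N ≥ 2, Σ_{1 ≤ k₁ < k₂ ≤ log N / log y, ⌊y^{k₁}⌋ < ⌊y^{k₂}⌋} Π_{p prime, p ∣ ⌊y^{k₂}⌋ − ⌊y^{k₁}⌋} (1 + 1/p) ≤ C (log N)². Then δ_y > 0, i.e., the set {p + ⌊y^k⌋ : p prime, k a positive integer} has positive lower asymptotic density. -/

import Mathlib

open MeasureTheory Filter

/-- `Sy y` is the set of natural numbers of the form `p + ⌊y^k⌋` with `p` prime and
`k` a positive integer. -/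
def Sy (y : ℝ) : Set ℕ :=
  {n : ℕ | ∃ p k : ℕ, p.Prime ∧ 1 ≤ k ∧ (n : ℤ) = (p : ℤ) + ⌊y ^ k⌋}

/-- `delta y` is the lower asymptotic density of `Sy y`:
`liminf_{N→∞} |Sy y ∩ [1,N]| / N`. -/
noncomputable def delta (y : ℝ) : ℝ :=
  Filter.liminf (fun N : ℕ =>
    (Nat.card {n : ℕ | n ∈ Sy y ∧ n ∈ Set.Icc 1 N} : ℝ) / (N : ℝ)) Filter.atTop


theorem rom_crt (a b : ℕ) (ha : 0 < a) (hb : 0 < b) (hab : a.Coprime b) (f g : ℕ → ℝ)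
    (hf : ∀ n, f (n % a) = f n) (hg : ∀ n, g (n % b) = g n) :
    ∑ n ∈ Finset.range (a * b), f n * g n
      = (∑ n ∈ Finset.range a, f n) * ∑ n ∈ Finset.range b, g n := by
  rw [Finset.sum_mul_sum, ← Finset.sum_product']
  refine Finset.sum_bij' (fun n _ => (n % a, n % b))
    (fun x _ => (Nat.chineseRemainder hab x.1 x.2 : ℕ)) ?_ ?_ ?_ ?_ ?_
  · intro n _
    simp [Nat.mod_lt _ ha, Nat.mod_lt _ hb]
  · intro x _
    simpa using Nat.chineseRemainder_lt_mul hab x.1 x.2 ha.ne' hb.ne'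
  · intro n hn
    have h1 := (Nat.chineseRemainder hab (n % a) (n % b)).2
    have h2 := Nat.chineseRemainder_lt_mul hab (n % a) (n % b) ha.ne' hb.ne'
    have h3 : (Nat.chineseRemainder hab (n % a) (n % b) : ℕ) ≡ n [MOD a * b] :=
      (Nat.modEq_and_modEq_iff_modEq_mul hab).1
        ⟨h1.1.trans (Nat.mod_modEq _ _), h1.2.trans (Nat.mod_modEq _ _)⟩
    exact Nat.ModEq.eq_of_lt_of_lt h3 h2 (by simpa using hn)
  · rintro ⟨i, j⟩ hx
    simp only [Finset.mem_product, Finset.mem_range] at hx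
    have h1 := (Nat.chineseRemainder hab i j).2
    ext
    · exact (show _ % a = _ % a from h1.1).trans (Nat.mod_eq_of_lt hx.1)
    · exact (show _ % b = _ % b from h1.2).trans (Nat.mod_eq_of_lt hx.2)
  · intro n _
    simp [hf, hg]

theorem rom_crt_prod (S : Finset ℕ) (hS : ∀ p ∈ S, p.Prime) (f : ℕ → ℕ → ℝ)
    (hf : ∀ p n, f p (n % p) = f p n) :
    ∑ n ∈ Finset.range (∏ p ∈ S, p), ∏ p ∈ S, f p n
      = ∏ p ∈ S, ∑ n ∈ Finset.range p, f p n := by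
  induction S using Finset.induction_on with
  | empty => simp
  | insert q S hq ih =>
    have hS' : ∀ p ∈ S, p.Prime := fun p hp => hS p (Finset.mem_insert_of_mem hp)
    have hqp := hS q (Finset.mem_insert_self _ _)
    rw [Finset.prod_insert hq, Finset.prod_insert hq, ← ih hS', ← rom_crt]
    · refine Finset.sum_congr rfl fun n _ => ?_
      rw [Finset.prod_insert hq]
    · exact hqp.pos
    · exact Finset.prod_pos fun p hp => (hS' p hp).pos
    · refine Nat.Coprime.prod_right fun p hp => ?_
      rw [Nat.coprime_primes hqp (hS' p hp)]
      rintro rfl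
      exact hq hp
    · exact hf q
    · intro n
      refine Finset.prod_congr rfl fun p hp => ?_
      rw [← hf p, Nat.mod_mod_of_dvd _ (Finset.dvd_prod_of_mem _ hp), hf]

/-- partial sums of a periodic function -/
theorem rom_periodic (L : ℕ) (hL : 0 < L) (f : ℕ → ℝ) (B : ℝ)
    (hf : ∀ n, f (n % L) = f n) (hB : ∀ n, |f n| ≤ B) (N : ℕ) :
    ∑ n ∈ Finset.range N, f n
      ≤ (N / L : ℕ) * (∑ n ∈ Finset.range L, f n) + L * B := by
  have hB0 : 0 ≤ B := (abs_nonneg _).trans (hB 0)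
  have key : ∀ q : ℕ, ∑ n ∈ Finset.range (L * q), f n = q * ∑ n ∈ Finset.range L, f n := by
    intro q
    induction q with
    | zero => simp
    | succ q ih =>
      rw [Nat.mul_succ, Finset.sum_range_add, ih]
      have : ∑ x ∈ Finset.range L, f (L * q + x) = ∑ x ∈ Finset.range L, f x := by
        refine Finset.sum_congr rfl fun x _ => ?_
        rw [← hf, Nat.mul_add_mod, hf]
      rw [this]; push_cast; ring
  conv_lhs => rw [← Nat.div_add_mod N L]
  rw [Finset.sum_range_add, key]
  gcongr
  calc ∑ x ∈ Finset.range (N % L), f (L * (N / L) + x)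
      ≤ ∑ x ∈ Finset.range (N % L), B := Finset.sum_le_sum fun x _ => (le_abs_self _).trans (hB _)
    _ = (N % L : ℕ) * B := by simp
    _ ≤ L * B := by
      gcongr
      exact (Nat.mod_lt _ hL).le

def romForb (h p : ℕ) : Finset ℕ := {0, (p - h % p) % p}

noncomputable def romG (h p : ℕ) : ℝ :=
  ((romForb h p).card : ℝ) / ((p : ℝ) - (romForb h p).card)

noncomputable def romPsi (h p n : ℕ) : ℝ := if n % p ∈ romForb h p then -1 else romG h p

noncomputable def romPsiL (h l n : ℕ) : ℝ := ∏ p ∈ l.primeFactors, romPsi h p n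

noncomputable def romGL (h l : ℕ) : ℝ := ∏ p ∈ l.primeFactors, romG h p

/-- odd squarefree numbers up to X -/
def romO (X : ℕ) : Finset ℕ := (Finset.Icc 1 X).filter (fun n => Squarefree n ∧ Odd n)

theorem romForb_card_le (h p : ℕ) : (romForb h p).card ≤ 2 := Finset.card_le_two

theorem romForb_card_pos (h p : ℕ) : 0 < (romForb h p).card := Finset.card_pos.2 ⟨0, by simp [romForb]⟩

theorem romG_pos (h p : ℕ) (hp : 3 ≤ p) : 0 < romG h p := by
  have h1 : ((romForb h p).card : ℝ) ≤ 2 := by exact_mod_cast romForb_card_le h p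
  have h2 : (0 : ℝ) < ((romForb h p).card : ℝ) := by exact_mod_cast romForb_card_pos h p
  have h3 : (3 : ℝ) ≤ p := by exact_mod_cast hp
  exact div_pos h2 (by linarith)

theorem romG_le (h p : ℕ) (hp : 3 ≤ p) : romG h p ≤ p := by
  have h1 : ((romForb h p).card : ℝ) ≤ 2 := by exact_mod_cast romForb_card_le h p
  have h2 : (0 : ℝ) < ((romForb h p).card : ℝ) := by exact_mod_cast romForb_card_pos h p
  have h3 : (3 : ℝ) ≤ p := by exact_mod_cast hp
  rw [romG, div_le_iff₀ (by linarith)]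
  nlinarith

theorem romPsi_abs (h p n : ℕ) (hp : 3 ≤ p) : |romPsi h p n| ≤ p := by
  have h3 : (3 : ℝ) ≤ p := by exact_mod_cast hp
  unfold romPsi
  split_ifs
  · simp; linarith
  · rw [abs_of_pos (romG_pos h p hp)]; exact romG_le h p hp

theorem romPsi_per (h p n : ℕ) : romPsi h p (n % p) = romPsi h p n := by simp [romPsi]

theorem romPsi_sum_aux (h p : ℕ) (hp : 3 ≤ p) (a b : ℝ) :
    ∑ n ∈ Finset.range p, (if n % p ∈ romForb h p then a else b)
      = (romForb h p).card * a + (p - (romForb h p).card) * b := by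
  have hsub : romForb h p ⊆ Finset.range p := by
    intro x hx
    simp only [romForb, Finset.mem_insert, Finset.mem_singleton] at hx
    rw [Finset.mem_range]
    rcases hx with rfl | rfl
    · omega
    · exact Nat.mod_lt _ (by omega)
  have : ∀ n ∈ Finset.range p, (if n % p ∈ romForb h p then a else b)
      = b + (if n ∈ romForb h p then a - b else 0) := by
    intro n hn
    rw [Nat.mod_eq_of_lt (Finset.mem_range.1 hn)]
    split_ifs <;> ring
  rw [Finset.sum_congr rfl this, Finset.sum_add_distrib, ← Finset.sum_filter,
    Finset.filter_mem_eq_inter, Finset.inter_eq_right.2 hsub]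
  simp
  ring

theorem romPsi_sum (h p : ℕ) (hp : 3 ≤ p) : ∑ n ∈ Finset.range p, romPsi h p n = 0 := by
  unfold romPsi
  rw [romPsi_sum_aux h p hp, romG]
  have h1 : ((romForb h p).card : ℝ) ≤ 2 := by exact_mod_cast romForb_card_le h p
  have h3 : (3 : ℝ) ≤ p := by exact_mod_cast hp
  have : (p : ℝ) - (romForb h p).card ≠ 0 := by linarith
  field_simp
  ring

theorem romPsi_sum_sq (h p : ℕ) (hp : 3 ≤ p) :
    ∑ n ∈ Finset.range p, romPsi h p n * romPsi h p n = p * romG h p := by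
  have : ∀ n, romPsi h p n * romPsi h p n
      = if n % p ∈ romForb h p then 1 else romG h p * romG h p := by
    intro n; unfold romPsi; split_ifs <;> ring
  simp_rw [this]
  rw [romPsi_sum_aux h p hp, romG]
  have h1 : ((romForb h p).card : ℝ) ≤ 2 := by exact_mod_cast romForb_card_le h p
  have h3 : (3 : ℝ) ≤ p := by exact_mod_cast hp
  have : (p : ℝ) - (romForb h p).card ≠ 0 := by linarith
  field_simp
  ring

theorem romO_prime (X l p : ℕ) (hl : l ∈ romO X) (hp : p ∈ l.primeFactors) : 3 ≤ p := by
  simp only [romO, Finset.mem_filter] at hl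
  have hpp := Nat.prime_of_mem_primeFactors hp
  have hd := Nat.dvd_of_mem_primeFactors hp
  have : Odd p := hl.2.2.of_dvd_nat hd
  have := hpp.two_le
  rcases this.eq_or_lt with h2 | h2
  · subst h2; exact absurd ‹Odd 2› (by decide)
  · exact h2

theorem romPsiL_abs (h X l n : ℕ) (hl : l ∈ romO X) : |romPsiL h l n| ≤ l := by
  unfold romPsiL
  rw [Finset.abs_prod]
  have hsq : Squarefree l := by simp only [romO, Finset.mem_filter] at hl; exact hl.2.1
  calc ∏ p ∈ l.primeFactors, |romPsi h p n| ≤ ∏ p ∈ l.primeFactors, (p : ℝ) :=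
        Finset.prod_le_prod (fun _ _ => abs_nonneg _)
          fun p hp => romPsi_abs h p n (romO_prime X l p hl hp)
    _ = l := by
      rw [← Nat.cast_prod, Nat.prod_primeFactors_of_squarefree hsq]

theorem romGL_pos (h X l : ℕ) (hl : l ∈ romO X) : 0 < romGL h l :=
  Finset.prod_pos fun p hp => romG_pos h p (romO_prime X l p hl hp)

theorem romPsiL_corr (h R l l' N : ℕ) (hl : l ∈ romO R) (hl' : l' ∈ romO R) :
    ∑ n ∈ Finset.range N, romPsiL h l n * romPsiL h l' n
      ≤ (if l = l' then N * romGL h l else 0) + R ^ 4 := by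
  have hl0 := hl
  have hl0' := hl'
  simp only [romO, Finset.mem_filter, Finset.mem_Icc] at hl hl'
  set S := l.primeFactors with hSd
  set T := l'.primeFactors with hTd
  have hS : ∏ p ∈ S, p = l := Nat.prod_primeFactors_of_squarefree hl.2.1
  have hT : ∏ p ∈ T, p = l' := Nat.prod_primeFactors_of_squarefree hl'.2.1
  have hprime : ∀ p ∈ S ∪ T, p.Prime := by
    intro p hp
    rcases Finset.mem_union.1 hp with hp | hp <;> exact Nat.prime_of_mem_primeFactors hp
  have h3 : ∀ p ∈ S ∪ T, 3 ≤ p := by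
    intro p hp
    rcases Finset.mem_union.1 hp with hp | hp
    · exact romO_prime R l p hl0 hp
    · exact romO_prime R l' p hl0' hp
  set L := ∏ p ∈ S ∪ T, p with hLd
  let f : ℕ → ℕ → ℝ := fun p n =>
    (if p ∈ S then romPsi h p n else 1) * (if p ∈ T then romPsi h p n else 1)
  have hfper : ∀ p n, f p (n % p) = f p n := by intro p n; simp [f, romPsi_per]
  have hprod : ∀ n, romPsiL h l n * romPsiL h l' n = ∏ p ∈ S ∪ T, f p n := by
    intro n
    simp only [f, Finset.prod_mul_distrib]
    rw [Finset.prod_ite_mem, Finset.prod_ite_mem, Finset.union_inter_cancel_left,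
      Finset.union_inter_cancel_right]
    rfl
  have hL : 0 < L := Finset.prod_pos fun p hp => (hprime p hp).pos
  have hLle : (L : ℝ) ≤ R ^ 2 := by
    have : L ≤ l * l' := by
      rw [← hS, ← hT, ← Finset.prod_union_inter]
      exact Nat.le_mul_of_pos_right _ (Finset.prod_pos fun p hp =>
        (hprime p (Finset.mem_union_left _ (Finset.mem_inter.1 hp).1)).pos)
    have h2 : l * l' ≤ R * R := Nat.mul_le_mul hl.1.2 hl'.1.2
    rw [sq]; exact_mod_cast this.trans h2
  have hB : ∀ n, |romPsiL h l n * romPsiL h l' n| ≤ (R : ℝ) ^ 2 := by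
    intro n
    rw [abs_mul, sq]
    have a1 := romPsiL_abs h R l n hl0
    have a2 := romPsiL_abs h R l' n hl0'
    have b1 : (l : ℝ) ≤ R := by exact_mod_cast hl.1.2
    have b2 : (l' : ℝ) ≤ R := by exact_mod_cast hl'.1.2
    exact mul_le_mul (a1.trans b1) (a2.trans b2) (abs_nonneg _) (by positivity)
  have main := rom_periodic L hL (fun n => romPsiL h l n * romPsiL h l' n) (R ^ 2) (by
    intro n
    simp only [hprod]
    refine Finset.prod_congr rfl fun p hp => ?_
    rw [← hfper p, Nat.mod_mod_of_dvd _ (Finset.dvd_prod_of_mem _ hp), hfper]) hB N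
  refine main.trans ?_
  have hsum : ∑ n ∈ Finset.range L, romPsiL h l n * romPsiL h l' n
      = if l = l' then L * romGL h l else 0 := by
    simp only [hprod]
    rw [rom_crt_prod _ hprime f hfper]
    split_ifs with heq
    · have hST : T = S := by rw [hSd, hTd, heq]
      rw [hLd, hST, Finset.union_self, romGL, Nat.cast_prod, ← Finset.prod_mul_distrib]
      refine Finset.prod_congr rfl fun p hp => ?_
      have := romPsi_sum_sq h p (h3 p (Finset.mem_union_left _ hp))
      simp only [f, hST, hp, if_true, this]
    · have hne : S ≠ T := by
        intro hST; apply heq; rw [← hS, ← hT, hST]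
      have : ∃ p ∈ S ∪ T, ∀ n, f p n = romPsi h p n := by
        by_contra hcon
        push Not at hcon
        apply hne
        ext p
        constructor
        · intro hp
          by_contra hp2
          obtain ⟨n, hn⟩ := hcon p (Finset.mem_union_left _ hp)
          exact hn (by simp [f, hp, hp2])
        · intro hp
          by_contra hp2
          obtain ⟨n, hn⟩ := hcon p (Finset.mem_union_right _ hp)
          exact hn (by simp [f, hp, hp2])
      obtain ⟨p, hp, hpf⟩ := this
      refine Finset.prod_eq_zero hp ?_
      simp only [hpf]
      exact romPsi_sum h p (h3 p hp)
  rw [hsum]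
  have hdiv : ((N / L : ℕ) : ℝ) * L ≤ N := by exact_mod_cast Nat.div_mul_le_self N L
  have hg := romGL_pos h R l hl0
  have hfin : (L : ℝ) * R ^ 2 ≤ R ^ 4 := by
    calc (L : ℝ) * R ^ 2 ≤ R ^ 2 * R ^ 2 := by gcongr
      _ = (R : ℝ) ^ 4 := by ring
  split_ifs
  · have : ((N / L : ℕ) : ℝ) * (L * romGL h l) ≤ N * romGL h l := by
      rw [← mul_assoc]; gcongr
    linarith
  · simpa using hfin

/-- the sieve -/
theorem rom_sieve (h R N : ℕ) (hR : 1 ≤ R) (A : Finset ℕ) (hA : A ⊆ Finset.range N)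
    (hA' : ∀ n ∈ A, ∀ p, p.Prime → p ≤ R → n % p ∉ romForb h p) :
    (A.card : ℝ) * (∑ l ∈ romO R, romGL h l)
      ≤ N + R ^ 6 := by
  set G := ∑ l ∈ romO R, romGL h l with hG
  have h1 : 1 ∈ romO R := by simp [romO, hR]
  have hG1 : 1 ≤ G := by
    calc (1 : ℝ) = romGL h 1 := by simp [romGL]
      _ ≤ G := Finset.single_le_sum (f := fun l => romGL h l)
        (fun l hl => (romGL_pos h R l hl).le) h1
  have hF : ∀ n ∈ A, ∑ l ∈ romO R, romPsiL h l n = G := by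
    intro n hn
    refine Finset.sum_congr rfl fun l hl => Finset.prod_congr rfl fun p hp => ?_
    have hpl := Nat.le_of_mem_primeFactors hp
    simp only [romO, Finset.mem_filter, Finset.mem_Icc] at hl
    rw [romPsi, if_neg (hA' n hn p (Nat.prime_of_mem_primeFactors hp) (hpl.trans hl.1.2))]
  have hcard : ((romO R).card : ℝ) ≤ R := by
    have : (romO R).card ≤ (Finset.Icc 1 R).card := Finset.card_filter_le _ _
    simp at this
    exact_mod_cast this
  have key : (A.card : ℝ) * G ^ 2 ≤ N * G + R ^ 6 := by
    calc (A.card : ℝ) * G ^ 2 = ∑ n ∈ A, (∑ l ∈ romO R, romPsiL h l n) ^ 2 := by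
          rw [Finset.sum_congr rfl fun n hn => by rw [hF n hn]]; simp
      _ ≤ ∑ n ∈ Finset.range N, (∑ l ∈ romO R, romPsiL h l n) ^ 2 :=
          Finset.sum_le_sum_of_subset_of_nonneg hA fun _ _ _ => sq_nonneg _
      _ = ∑ l ∈ romO R, ∑ l' ∈ romO R, ∑ n ∈ Finset.range N, romPsiL h l n * romPsiL h l' n := by
          simp_rw [sq, Finset.sum_mul_sum]
          rw [Finset.sum_comm]
          refine Finset.sum_congr rfl fun l _ => ?_
          rw [Finset.sum_comm]
      _ ≤ ∑ l ∈ romO R, ∑ l' ∈ romO R, ((if l = l' then N * romGL h l else 0) + (R : ℝ) ^ 4) :=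
          Finset.sum_le_sum fun l hl => Finset.sum_le_sum fun l' hl' =>
            romPsiL_corr h R l l' N hl hl'
      _ = N * G + (romO R).card * ((romO R).card * (R : ℝ) ^ 4) := by
          simp_rw [Finset.sum_add_distrib]
          rw [hG, Finset.mul_sum]
          simp
      _ ≤ N * G + R * (R * (R : ℝ) ^ 4) := by gcongr
      _ = N * G + R ^ 6 := by ring
  have : (R : ℝ) ^ 6 ≤ R ^ 6 * G := le_mul_of_one_le_right (by positivity) hG1
  nlinarith

theorem rom_sum_inj {α β : Type*} [DecidableEq β] (s : Finset α) (t : Finset β) (f : α → ℝ) (F : β → ℝ)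
    (i : α → β) (j : β → α) (hi : ∀ x ∈ s, i x ∈ t) (hj : ∀ x ∈ s, j (i x) = x)
    (hf : ∀ x ∈ s, f x ≤ F (i x)) (hF : ∀ y ∈ t, 0 ≤ F y) : ∑ x ∈ s, f x ≤ ∑ y ∈ t, F y := by
  have hinj : Set.InjOn i s := fun x hx y hy hxy => by
    rw [← hj x hx, ← hj y hy, hxy]
  calc ∑ x ∈ s, f x ≤ ∑ x ∈ s, F (i x) := Finset.sum_le_sum hf
    _ = ∑ y ∈ s.image i, F y := (Finset.sum_image hinj).symm
    _ ≤ ∑ y ∈ t, F y := Finset.sum_le_sum_of_subset_of_nonneg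
        (Finset.image_subset_iff.2 hi) fun y hy _ => hF y hy

theorem rom_zeta2 (X : ℕ) : ∑ s ∈ Finset.Icc 1 X, (1 : ℝ) / (s : ℝ) ^ 2 ≤ 2 := by
  have : ∀ X : ℕ, ∑ s ∈ Finset.Icc 1 (X + 1), (1 : ℝ) / (s : ℝ) ^ 2 ≤ 2 - 1 / ((X : ℝ) + 1) := by
    intro X
    induction X with
    | zero => norm_num
    | succ n ih =>
      rw [Finset.sum_Icc_succ_top (by omega)]
      have : (1 : ℝ) / ((n + 1 + 1 : ℕ) : ℝ) ^ 2 ≤ 1 / ((n : ℝ) + 1) - 1 / (((n + 1 : ℕ) : ℝ) + 1) := by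
        push_cast
        rw [div_sub_div _ _ (by positivity) (by positivity), div_le_div_iff₀ (by positivity) (by positivity)]
        nlinarith [(n.cast_nonneg : (0 : ℝ) ≤ n)]
      linarith
  rcases X with _ | X
  · simp
  · refine (this X).trans ?_
    have : (0 : ℝ) ≤ 1 / ((X : ℝ) + 1) := by positivity
    linarith

theorem rom_step1 (X : ℕ) : Real.log (X + 1) ≤ 3 * ∑ a ∈ romO X, (1 : ℝ) / a := by
  have h1 : Real.log (X + 1) ≤ ∑ n ∈ Finset.Icc 1 X, (1 : ℝ) / n := by
    have := log_add_one_le_harmonic X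
    rw [harmonic_eq_sum_Icc] at this
    push_cast at this
    simpa using this
  refine h1.trans ?_
  -- target set : s, e, a
  let D := (Finset.Icc 1 X ×ˢ ({1, 2} : Finset ℕ)) ×ˢ romO X
  let F : (ℕ × ℕ) × ℕ → ℝ := fun x => 1 / (x.1.1 : ℝ) ^ 2 * (1 / x.1.2) * (1 / x.2)
  have hD : ∑ x ∈ D, F x ≤ 3 * ∑ a ∈ romO X, (1 : ℝ) / a := by
    have : ∑ x ∈ D, F x = (∑ s ∈ Finset.Icc 1 X, (1 : ℝ) / (s : ℝ) ^ 2) * (∑ e ∈ ({1, 2} : Finset ℕ), (1 : ℝ) / e)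
        * ∑ a ∈ romO X, (1 : ℝ) / a := by
      rw [Finset.sum_mul_sum, ← Finset.sum_product', Finset.sum_mul_sum, ← Finset.sum_product']
    rw [this]
    have h2 := rom_zeta2 X
    have h3 : ∑ e ∈ ({1, 2} : Finset ℕ), (1 : ℝ) / e = 3 / 2 := by norm_num
    rw [h3]
    have : 0 ≤ ∑ a ∈ romO X, (1 : ℝ) / a := Finset.sum_nonneg fun _ _ => by positivity
    nlinarith
  refine le_trans ?_ hD
  have hex : ∀ n ∈ Finset.Icc 1 X, ∃ x ∈ D, x.1.1 ^ 2 * x.1.2 * x.2 = n := by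
    intro n hn
    rw [Finset.mem_Icc] at hn
    obtain ⟨a, b, hab, hsq⟩ := Nat.sq_mul_squarefree n
    have hb : 0 < b := by
      rcases Nat.eq_zero_or_pos b with h | h
      · subst h; simp at hab; omega
      · exact h
    have ha : 0 < a := by
      rcases Nat.eq_zero_or_pos a with h | h
      · subst h; simp at hsq
      · exact h
    have hbX : b ≤ X := by nlinarith
    have haX : a ≤ X := by
      have : a ≤ b ^ 2 * a := Nat.le_mul_of_pos_left _ (by positivity)
      omega
    rcases Nat.even_or_odd a with he | ho
    · obtain ⟨c, hc⟩ := he.two_dvd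
      subst hc
      have hcsq : Squarefree c := hsq.squarefree_of_dvd (Dvd.intro_left _ rfl)
      have hcodd : Odd c := by
        by_contra hne
        rw [Nat.not_odd_iff_even] at hne
        obtain ⟨d, hd⟩ := hne.two_dvd
        have := hsq 2 ⟨d, by rw [hd]; ring⟩
        simp at this
      refine ⟨((b, 2), c), ?_, ?_⟩
      · simp [D, romO, hcsq, hcodd]; omega
      · simp; rw [← hab]; ring
    · refine ⟨((b, 1), a), ?_, ?_⟩
      · simp [D, romO, hsq, ho]; omega
      · simp [hab]
  choose! i hiD hi using hex
  refine rom_sum_inj _ D _ F i (fun x => x.1.1 ^ 2 * x.1.2 * x.2) hiD hi ?_ ?_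
  · intro n hn
    refine le_of_eq ?_
    conv_lhs => rw [← hi n hn]
    simp only [F]
    push_cast
    rw [one_div_mul_one_div, one_div_mul_one_div]
  · intro y _
    simp only [F]
    positivity

theorem rom_step3 (h X : ℕ) (hh : h ≠ 0) : ∑ b ∈ romO X, (1 : ℝ) / b
    ≤ (∏ p ∈ h.primeFactors, (1 + 1 / (p : ℝ))) *
      ∑ b ∈ (romO X).filter (fun b => b.Coprime h), (1 : ℝ) / b := by
  rw [Finset.prod_one_add, Finset.sum_mul_sum, ← Finset.sum_product']
  refine rom_sum_inj _ _ _ (fun x : Finset ℕ × ℕ => (∏ p ∈ x.1, (1 : ℝ) / p) * (1 / x.2))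
    (fun b => (b.primeFactors ∩ h.primeFactors, ∏ p ∈ b.primeFactors \ h.primeFactors, p))
    (fun x => (∏ p ∈ x.1, p) * x.2) ?_ ?_ ?_ ?_
  · intro b hb
    simp only [romO, Finset.mem_filter, Finset.mem_Icc] at hb
    have hd : ∏ p ∈ b.primeFactors \ h.primeFactors, p ∣ b := by
      conv_rhs => rw [← Nat.prod_primeFactors_of_squarefree hb.2.1]
      exact Finset.prod_dvd_prod_of_subset _ _ _ Finset.sdiff_subset
    simp only [Finset.mem_product, Finset.mem_powerset, Finset.inter_subset_right, true_and,
      Finset.mem_filter, romO, Finset.mem_Icc]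
    refine ⟨⟨⟨Nat.pos_of_dvd_of_pos hd hb.1.1, (Nat.le_of_dvd hb.1.1 hd).trans hb.1.2⟩,
      hb.2.1.squarefree_of_dvd hd, hb.2.2.of_dvd_nat hd⟩, ?_⟩
    refine Nat.Coprime.prod_left fun p hp => ?_
    rw [Finset.mem_sdiff] at hp
    have hpp := Nat.prime_of_mem_primeFactors hp.1
    rw [hpp.coprime_iff_not_dvd]
    intro hph
    exact hp.2 (Nat.mem_primeFactors.2 ⟨hpp, hph, hh⟩)
  · intro b hb
    simp only [romO, Finset.mem_filter, Finset.mem_Icc] at hb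
    simp only
    rw [Finset.prod_inter_mul_prod_sdiff, Nat.prod_primeFactors_of_squarefree hb.2.1]
  · intro b hb
    simp only [romO, Finset.mem_filter, Finset.mem_Icc] at hb
    simp only
    conv_lhs => rw [← Nat.prod_primeFactors_of_squarefree hb.2.1, ← Finset.prod_inter_mul_prod_sdiff _ h.primeFactors]
    push_cast
    simp
    rw [mul_comm]
  · intro y _
    positivity

theorem rom_step2 (h X : ℕ) : (∑ a ∈ romO X, (1 : ℝ) / a) *
      (∑ b ∈ (romO X).filter (fun b => b.Coprime h), (1 : ℝ) / b)
    ≤ 2 * ∑ l ∈ romO (X ^ 2), ((l.divisors.filter (fun d => d.Coprime h)).card : ℝ) / l := by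
  have e1 : ∑ l ∈ romO (X ^ 2), ((l.divisors.filter (fun d => d.Coprime h)).card : ℝ) / l
      = ∑ x ∈ (romO (X ^ 2)).sigma (fun l => l.divisors.filter (fun d => d.Coprime h)), (1 : ℝ) / x.1 := by
    rw [Finset.sum_sigma]
    simp [div_eq_mul_inv]
  have h0 : 0 ≤ ∑ l ∈ romO (X ^ 2), ((l.divisors.filter (fun d => d.Coprime h)).card : ℝ) / l :=
    Finset.sum_nonneg fun _ _ => by positivity
  refine le_trans ?_ (mul_le_mul_of_nonneg_right (rom_zeta2 X) h0)
  rw [e1, Finset.sum_mul_sum, Finset.sum_mul_sum, ← Finset.sum_product', ← Finset.sum_product']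
  refine rom_sum_inj _ _ _
    (fun x : ℕ × (Σ _ : ℕ, ℕ) => (1 : ℝ) / (x.1 : ℝ) ^ 2 * (1 / x.2.1))
    (fun x => (x.1.gcd x.2, ⟨(x.1 / x.1.gcd x.2) * (x.2 / x.1.gcd x.2), x.2 / x.1.gcd x.2⟩))
    (fun x => (x.1 * (x.2.1 / x.2.2), x.1 * x.2.2)) ?_ ?_ ?_ ?_
  · rintro ⟨a, b⟩ hx
    simp only [romO, Finset.mem_filter, Finset.mem_Icc, Finset.mem_product] at hx
    obtain ⟨⟨⟨ha1, haX⟩, hasq, haodd⟩, ⟨⟨hb1, hbX⟩, hbsq, hbodd⟩, hbh⟩ := hx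
    obtain ⟨g, a', b', hg, hcop, rfl, rfl⟩ := Nat.exists_coprime' (m := a) (n := b) (Nat.gcd_pos_of_pos_left _ ha1)
    have hgcd : (a' * g).gcd (b' * g) = g := by rw [Nat.gcd_mul_right, hcop.gcd_eq_one, one_mul]
    simp only [hgcd, Nat.mul_div_cancel _ hg, Finset.mem_product, Finset.mem_Icc, Finset.mem_sigma,
      romO, Finset.mem_filter, Nat.mem_divisors]
    have ha' : 0 < a' := Nat.pos_of_mul_pos_right ha1
    have hb' : 0 < b' := Nat.pos_of_mul_pos_right hb1
    have h1 : a' ≤ X := (Nat.le_mul_of_pos_right _ hg).trans haX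
    have h2 : b' ≤ X := (Nat.le_mul_of_pos_right _ hg).trans hbX
    refine ⟨⟨hg, (Nat.le_mul_of_pos_left _ ha').trans haX⟩, ⟨⟨Nat.mul_pos ha' hb', ?_⟩, ?_, ?_⟩,
      ⟨Dvd.intro_left _ rfl, (Nat.mul_pos ha' hb').ne'⟩, hbh.coprime_dvd_left (Dvd.intro _ rfl)⟩
    · rw [sq]; exact Nat.mul_le_mul h1 h2
    · exact (Nat.squarefree_mul hcop).2 ⟨hasq.squarefree_of_dvd (Dvd.intro _ rfl),
        hbsq.squarefree_of_dvd (Dvd.intro _ rfl)⟩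
    · exact (haodd.of_dvd_nat (Dvd.intro _ rfl)).mul (hbodd.of_dvd_nat (Dvd.intro _ rfl))
  · rintro ⟨a, b⟩ hx
    simp only [romO, Finset.mem_filter, Finset.mem_Icc, Finset.mem_product] at hx
    obtain ⟨⟨⟨ha1, haX⟩, hasq, haodd⟩, ⟨⟨hb1, hbX⟩, hbsq, hbodd⟩, hbh⟩ := hx
    have hg : 0 < a.gcd b := Nat.gcd_pos_of_pos_left _ ha1
    simp only
    rw [Nat.mul_div_cancel _ (Nat.div_pos (Nat.gcd_le_right _ hb1) hg),
      Nat.mul_div_cancel' (Nat.gcd_dvd_left _ _), Nat.mul_div_cancel' (Nat.gcd_dvd_right _ _)]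
  · rintro ⟨a, b⟩ hx
    simp only [romO, Finset.mem_filter, Finset.mem_Icc, Finset.mem_product] at hx
    obtain ⟨⟨⟨ha1, haX⟩, hasq, haodd⟩, ⟨⟨hb1, hbX⟩, hbsq, hbodd⟩, hbh⟩ := hx
    have hg : (0 : ℝ) < (a.gcd b : ℕ) := by exact_mod_cast Nat.gcd_pos_of_pos_left _ ha1
    simp only
    push_cast [Nat.cast_div (Nat.gcd_dvd_left a b) hg.ne', Nat.cast_div (Nat.gcd_dvd_right a b) hg.ne']
    have h1 : (0 : ℝ) < a := by exact_mod_cast ha1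
    have h2 : (0 : ℝ) < b := by exact_mod_cast hb1
    apply le_of_eq
    field_simp
  · intro y _
    positivity

theorem romForb_card_eq (h p : ℕ) (hp : 0 < p) (hph : ¬ p ∣ h) : (romForb h p).card = 2 := by
  refine Finset.card_pair ?_
  intro h0
  have h1 : h % p ≠ 0 := fun h2 => hph (Nat.dvd_of_mod_eq_zero h2)
  have h2 := Nat.mod_lt h hp
  rw [Nat.mod_eq_of_lt (by omega)] at h0
  omega

theorem rom_step4 (h X l : ℕ) (hl : l ∈ romO X) :
    ((l.divisors.filter (fun d => d.Coprime h)).card : ℝ) / l ≤ romGL h l := by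
  have hl0 := hl
  simp only [romO, Finset.mem_filter, Finset.mem_Icc] at hl
  have hc : (l.divisors.filter (fun d => d.Coprime h)).card
      ≤ 2 ^ (l.primeFactors.filter (fun p => ¬ p ∣ h)).card := by
    rw [← Finset.card_powerset]
    refine Finset.card_le_card_of_injOn (fun d => d.primeFactors) ?_ ?_
    · intro d hd
      simp only [Finset.coe_filter, Nat.mem_divisors, Set.mem_ofPred_eq] at hd
      simp only [Finset.coe_powerset, Set.mem_preimage, Set.mem_powerset_iff, Finset.coe_subset]
      intro p hp
      have hpp := Nat.prime_of_mem_primeFactors hp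
      have hpd := Nat.dvd_of_mem_primeFactors hp
      refine Finset.mem_filter.2 ⟨Nat.mem_primeFactors.2 ⟨hpp, hpd.trans hd.1.1, hd.1.2⟩, ?_⟩
      exact (hpp.coprime_iff_not_dvd).1 (hd.2.coprime_dvd_left hpd)
    · intro d hd d' hd' hdd
      simp only [Finset.coe_filter, Nat.mem_divisors, Set.mem_ofPred_eq] at hd hd'
      rw [← Nat.prod_primeFactors_of_squarefree (hl.2.1.squarefree_of_dvd hd.1.1),
        ← Nat.prod_primeFactors_of_squarefree (hl.2.1.squarefree_of_dvd hd'.1.1)]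
      simp only at hdd
      rw [hdd]
  have hc' : ((l.divisors.filter (fun d => d.Coprime h)).card : ℝ)
      ≤ ∏ p ∈ l.primeFactors, (if ¬ p ∣ h then (2 : ℝ) else 1) := by
    rw [Finset.prod_ite]
    simp only [Finset.prod_const, one_pow, mul_one]
    exact_mod_cast hc
  have hll : (l : ℝ) = ∏ p ∈ l.primeFactors, (p : ℝ) := by
    rw [← Nat.cast_prod, Nat.prod_primeFactors_of_squarefree hl.2.1]
  calc _ ≤ (∏ p ∈ l.primeFactors, (if ¬ p ∣ h then (2 : ℝ) else 1)) / l := by gcongr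
    _ = ∏ p ∈ l.primeFactors, ((if ¬ p ∣ h then (2 : ℝ) else 1) / p) := by
      rw [Finset.prod_div_distrib, ← hll]
    _ ≤ romGL h l := by
      refine Finset.prod_le_prod (fun p _ => by split_ifs <;> positivity) fun p hp => ?_
      have h3 := romO_prime X l p hl0 hp
      have h3' : (3 : ℝ) ≤ p := by exact_mod_cast h3
      have h1 : ((romForb h p).card : ℝ) ≤ 2 := by exact_mod_cast romForb_card_le h p
      have h2 : (1 : ℝ) ≤ ((romForb h p).card : ℝ) := by exact_mod_cast romForb_card_pos h p
      rw [romG]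
      apply div_le_div₀ (by positivity) _ (by linarith) (by linarith)
      split_ifs with hd
      · exact h2
      · rw [romForb_card_eq h p (by omega) hd]; norm_num

theorem rom_G_lower (h X : ℕ) (hh : h ≠ 0) :
    Real.log (X + 1) ^ 2 ≤ 18 * (∏ p ∈ h.primeFactors, (1 + 1 / (p : ℝ))) *
      ∑ l ∈ romO (X ^ 2), romGL h l := by
  have h1 := rom_step1 X
  have h3 := rom_step3 h X hh
  have h2 := rom_step2 h X
  have h4 : ∑ l ∈ romO (X ^ 2), ((l.divisors.filter (fun d => d.Coprime h)).card : ℝ) / l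
      ≤ ∑ l ∈ romO (X ^ 2), romGL h l := Finset.sum_le_sum fun l hl => rom_step4 h _ l hl
  have hlog : 0 ≤ Real.log (X + 1) := Real.log_nonneg (by simp)
  set P := ∏ p ∈ h.primeFactors, (1 + 1 / (p : ℝ)) with hP
  have hP0 : 0 ≤ P := Finset.prod_nonneg fun _ _ => by positivity
  set a := ∑ a ∈ romO X, (1 : ℝ) / a
  set b := ∑ b ∈ (romO X).filter (fun b => b.Coprime h), (1 : ℝ) / b
  have ha : 0 ≤ a := Finset.sum_nonneg fun _ _ => by positivity
  calc Real.log (X + 1) ^ 2 ≤ (3 * a) ^ 2 := by gcongr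
    _ = 9 * (a * a) := by ring
    _ ≤ 9 * (a * (P * b)) := by gcongr
    _ = 9 * P * (a * b) := by ring
    _ ≤ 9 * P * (2 * ∑ l ∈ romO (X ^ 2), romGL h l) := by
      refine mul_le_mul_of_nonneg_left (h2.trans ?_) (by positivity)
      exact mul_le_mul_of_nonneg_left h4 (by norm_num)
    _ = _ := by ring

def romT (h N : ℕ) : Finset ℕ := (Finset.range (N + 1)).filter (fun p => p.Prime ∧ (p + h).Prime)

theorem rom_pairs (h N : ℕ) (hh : h ≠ 0) (hN : 2 ≤ N) :
    ((romT h N).card : ℝ) * Real.log N ^ 2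
      ≤ 32000 * N * ∏ p ∈ h.primeFactors, (1 + 1 / (p : ℝ)) := by
  set P := ∏ p ∈ h.primeFactors, (1 + 1 / (p : ℝ)) with hP
  have hP1 : 1 ≤ P := by
    rw [hP]
    have : ∏ p ∈ h.primeFactors, (1 : ℝ) ≤ ∏ p ∈ h.primeFactors, (1 + 1 / (p : ℝ)) := by
      refine Finset.prod_le_prod (fun _ _ => zero_le_one) fun p _ => ?_
      have : (0 : ℝ) ≤ 1 / p := by positivity
      linarith
    simpa using this
  have hN' : (2 : ℝ) ≤ N := by exact_mod_cast hN
  have hN0 : (0 : ℝ) < N := by linarith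
  have hlog : 0 < Real.log N := Real.log_pos (by linarith)
  set z : ℝ := (N : ℝ) ^ (1 / 24 : ℝ) with hz
  have hz0 : 0 ≤ z := by positivity
  have hz1 : 1 ≤ z := Real.one_le_rpow (by linarith) (by norm_num)
  have hz12 : z ^ 12 = Real.sqrt N := by
    rw [hz, ← Real.rpow_natCast, ← Real.rpow_mul hN0.le, Real.sqrt_eq_rpow]
    norm_num
  have hz24 : z ^ 24 = N := by
    rw [hz, ← Real.rpow_natCast, ← Real.rpow_mul hN0.le]
    norm_num
  have hlz : Real.log z = Real.log N / 24 := by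
    rw [hz, Real.log_rpow hN0]; ring
  set X := ⌊z⌋₊ with hX
  have hXz : (X : ℝ) ≤ z := Nat.floor_le hz0
  have hX1 : 1 ≤ X := Nat.le_floor (by simpa using hz1)
  have hX1' : (1 : ℝ) ≤ X := by exact_mod_cast hX1
  have hzX : z ≤ X + 1 := (Nat.lt_floor_add_one z).le
  have hlogX : Real.log N / 24 ≤ Real.log (X + 1) := by
    rw [← hlz]; exact Real.log_le_log (by linarith) hzX
  have hG := rom_G_lower h X hh
  set G := ∑ l ∈ romO (X ^ 2), romGL h l with hGd
  have hG2 : (Real.log N / 24) ^ 2 ≤ 18 * P * G := le_trans (by gcongr) hG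
  set A := (romT h N).filter (fun p => X ^ 2 < p) with hA
  have hs := rom_sieve h (X ^ 2) (N + 1) (Nat.one_le_pow _ _ hX1) A (by
      intro p hp
      simp only [hA, romT, Finset.mem_filter] at hp
      exact hp.1.1) (by
      intro n hn p hp hpR hmem
      simp only [hA, romT, Finset.mem_filter] at hn
      obtain ⟨⟨_, hn1, hn2⟩, hn3⟩ := hn
      simp only [romForb, Finset.mem_insert, Finset.mem_singleton] at hmem
      rcases hmem with h0 | h0
      · have := (Nat.prime_dvd_prime_iff_eq hp hn1).1 (Nat.dvd_of_mod_eq_zero h0)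
        omega
      · have hd : p ∣ n + h := by
          have h1 : n ≡ p - h % p [MOD p] := h0
          have h2 : n + h ≡ (p - h % p) + h % p [MOD p] := h1.add (Nat.mod_modEq h p).symm
          rw [Nat.sub_add_cancel (Nat.mod_lt _ hp.pos).le] at h2
          exact (h2.dvd_iff dvd_rfl).2 dvd_rfl
        have := (Nat.prime_dvd_prime_iff_eq hp hn2).1 hd
        omega)
  have hX12 : (X : ℝ) ^ 12 ≤ z ^ 12 := by gcongr
  have hX24 : (X : ℝ) ^ 12 ≤ N := by
    rw [← hz24]
    exact hX12.trans (pow_le_pow_right₀ hz1 (by norm_num))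
  have hs' : (A.card : ℝ) * G ≤ 3 * N := by
    refine hs.trans ?_
    push_cast
    have : ((X : ℝ) ^ 2) ^ 6 = X ^ 12 := by ring
    rw [this]
    linarith
  have hTA : ((romT h N).card : ℝ) ≤ A.card + X ^ 2 := by
    have h1 : (romT h N).card = A.card + ((romT h N).filter (fun p => ¬ X ^ 2 < p)).card :=
      (Finset.card_filter_add_card_filter_not _).symm
    have h2 : ((romT h N).filter (fun p => ¬ X ^ 2 < p)).card ≤ (Finset.Icc 1 (X ^ 2)).card := by
      refine Finset.card_le_card ?_
      intro p hp
      simp only [romT, Finset.mem_filter] at hp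
      have := hp.1.2.1.pos
      rw [Finset.mem_Icc]
      omega
    rw [Nat.card_Icc] at h2
    have : (romT h N).card ≤ A.card + X ^ 2 := by omega
    exact_mod_cast this
  have hA0 : (0 : ℝ) ≤ A.card := by positivity
  have t1 : (A.card : ℝ) * Real.log N ^ 2 ≤ 31104 * N * P := by
    calc (A.card : ℝ) * Real.log N ^ 2 = 576 * (A.card * (Real.log N / 24) ^ 2) := by ring
      _ ≤ 576 * (A.card * (18 * P * G)) := by gcongr
      _ = 10368 * P * (A.card * G) := by ring
      _ ≤ 10368 * P * (3 * N) := by gcongr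
      _ = _ := by ring
  have t2 : (X : ℝ) ^ 2 * Real.log N ^ 2 ≤ 16 * N := by
    have h1 : Real.log N ≤ 4 * z ^ 6 := by
      have := Real.log_le_rpow_div hN0.le (show (0 : ℝ) < 1 / 4 by norm_num)
      have e : (N : ℝ) ^ (1 / 4 : ℝ) = z ^ 6 := by
        rw [hz, ← Real.rpow_natCast, ← Real.rpow_mul hN0.le]
        norm_num
      rw [e] at this
      linarith
    have h2 : (X : ℝ) ^ 2 ≤ z ^ 12 :=
      (pow_le_pow_right₀ hX1' (by norm_num)).trans hX12
    calc (X : ℝ) ^ 2 * Real.log N ^ 2 ≤ z ^ 12 * (4 * z ^ 6) ^ 2 := by gcongr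
      _ = 16 * z ^ 24 := by ring
      _ = 16 * N := by rw [hz24]
  calc ((romT h N).card : ℝ) * Real.log N ^ 2 ≤ (A.card + X ^ 2) * Real.log N ^ 2 := by gcongr
    _ = A.card * Real.log N ^ 2 + X ^ 2 * Real.log N ^ 2 := by ring
    _ ≤ 31104 * N * P + 16 * N := add_le_add t1 t2
    _ ≤ 32000 * N * P := by nlinarith

theorem rom_cs {α : Type*} [DecidableEq α] (s : Finset α) (f : α → ℕ) :
    s.card ^ 2 ≤ (s.image f).card * ((s ×ˢ s).filter (fun x => f x.1 = f x.2)).card := by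
  have h1 : s.card = ∑ n ∈ s.image f, (s.filter (fun x => f x = n)).card :=
    Finset.card_eq_sum_card_image f s
  have h2 : ((s ×ˢ s).filter (fun x => f x.1 = f x.2)).card
      = ∑ n ∈ s.image f, (s.filter (fun x => f x = n)).card ^ 2 := by
    rw [Finset.card_eq_sum_card_fiberwise (f := fun x => f x.1) (t := s.image f)]
    · refine Finset.sum_congr rfl fun n _ => ?_
      rw [sq, ← Finset.card_product]
      congr 1
      ext ⟨a, b⟩
      simp only [Finset.mem_filter, Finset.mem_product]
      constructor
      · rintro ⟨⟨⟨ha, hb⟩, h⟩, h'⟩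
        exact ⟨⟨ha, h'⟩, hb, by rw [← h, h']⟩
      · rintro ⟨⟨ha, h'⟩, hb, h''⟩
        exact ⟨⟨⟨ha, hb⟩, by rw [h', h'']⟩, h'⟩
    · intro x hx
      simp only [Finset.coe_filter, Finset.mem_product, Set.mem_ofPred_eq] at hx
      exact Finset.mem_coe.2 (Finset.mem_image_of_mem f hx.1.1)
  rw [h2]
  conv_lhs => rw [h1]
  exact sq_sum_le_card_mul_sum_sq

def romP (N : ℕ) : Finset ℕ := (Finset.range (N + 1)).filter Nat.Prime

theorem rom_energy (N : ℕ) (Ks : Finset ℕ) (m : ℕ → ℕ) (hm : StrictMonoOn m Ks) :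
    (((romP N ×ˢ Ks) ×ˢ (romP N ×ˢ Ks)).filter
        (fun x => x.1.1 + m x.1.2 = x.2.1 + m x.2.2)).card
      ≤ (romP N ×ˢ Ks).card + 2 * ∑ kk ∈ (Ks ×ˢ Ks).filter (fun kk => kk.1 < kk.2),
        (romT (m kk.2 - m kk.1) N).card := by
  rw [Finset.card_eq_sum_card_fiberwise (f := fun x => (x.1.2, x.2.2)) (t := Ks ×ˢ Ks)]
  · have hb : ∀ kk ∈ Ks ×ˢ Ks,
      (((((romP N ×ˢ Ks) ×ˢ (romP N ×ˢ Ks)).filter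
        (fun x => x.1.1 + m x.1.2 = x.2.1 + m x.2.2))).filter (fun x => (x.1.2, x.2.2) = kk)).card
      ≤ (if kk.1 = kk.2 then (romP N).card else 0)
        + (if kk.1 < kk.2 then (romT (m kk.2 - m kk.1) N).card else 0)
        + (if kk.2 < kk.1 then (romT (m kk.1 - m kk.2) N).card else 0) := by
      rintro ⟨k, k'⟩ hkk
      rw [Finset.mem_product] at hkk
      simp only
      rcases lt_trichotomy k k' with hlt | heq | hlt
      · rw [if_neg hlt.ne, if_pos hlt, if_neg hlt.not_gt, zero_add, add_zero]
        have hmm : m k < m k' := hm hkk.1 hkk.2 hlt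
        refine Finset.card_le_card_of_injOn (fun x => x.2.1) ?_ ?_
        · rintro ⟨⟨p, a⟩, ⟨p', b⟩⟩ hx
          simp only [Finset.coe_filter, Finset.mem_filter, Finset.mem_product, Set.mem_ofPred_eq, romP, Prod.mk.injEq, Finset.mem_range] at hx
          obtain ⟨⟨⟨⟨⟨h1, h2⟩, h3⟩, ⟨h4, h5⟩, h6⟩, h7⟩, rfl, rfl⟩ := hx
          simp only [romT, Finset.coe_filter, Set.mem_ofPred_eq, Finset.mem_range]
          refine ⟨h4, h5, ?_⟩
          have : p' + (m b - m a) = p := by omega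
          rw [this]; exact h2
        · rintro ⟨⟨p, a⟩, ⟨p', b⟩⟩ hx ⟨⟨q, c⟩, ⟨q', d⟩⟩ hy hxy
          simp only [Finset.coe_filter, Finset.mem_filter, Finset.mem_product, Set.mem_ofPred_eq, romP, Prod.mk.injEq, Finset.mem_range] at hx hy hxy
          obtain ⟨⟨-, h7⟩, rfl, rfl⟩ := hx
          obtain ⟨⟨-, h8⟩, rfl, rfl⟩ := hy
          simp only [Prod.mk.injEq, and_true]
          omega
      · subst heq
        simp only [lt_irrefl, if_true, if_false, add_zero]
        refine Finset.card_le_card_of_injOn (fun x => x.2.1) ?_ ?_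
        · rintro ⟨⟨p, a⟩, ⟨p', b⟩⟩ hx
          simp only [Finset.coe_filter, Finset.mem_filter, Finset.mem_product, Set.mem_ofPred_eq] at hx
          exact hx.1.1.2.1
        · rintro ⟨⟨p, a⟩, ⟨p', b⟩⟩ hx ⟨⟨q, c⟩, ⟨q', d⟩⟩ hy hxy
          simp only [Finset.coe_filter, Finset.mem_filter, Finset.mem_product, Set.mem_ofPred_eq, romP, Prod.mk.injEq, Finset.mem_range] at hx hy hxy
          obtain ⟨⟨-, h7⟩, h9, h10⟩ := hx
          obtain ⟨⟨-, h8⟩, h11, h12⟩ := hy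
          subst h9 h10 h11 h12
          simp only [Prod.mk.injEq, and_true]
          omega
      · rw [if_neg hlt.ne', if_neg hlt.not_gt, if_pos hlt, zero_add, zero_add]
        have hmm : m k' < m k := hm hkk.2 hkk.1 hlt
        refine Finset.card_le_card_of_injOn (fun x => x.1.1) ?_ ?_
        · rintro ⟨⟨p, a⟩, ⟨p', b⟩⟩ hx
          simp only [Finset.coe_filter, Finset.mem_filter, Finset.mem_product, Set.mem_ofPred_eq, romP, Prod.mk.injEq, Finset.mem_range] at hx
          obtain ⟨⟨⟨⟨⟨h1, h2⟩, h3⟩, ⟨h4, h5⟩, h6⟩, h7⟩, rfl, rfl⟩ := hx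
          simp only [romT, Finset.coe_filter, Set.mem_ofPred_eq, Finset.mem_range]
          refine ⟨h1, h2, ?_⟩
          have : p + (m a - m b) = p' := by omega
          rw [this]; exact h5
        · rintro ⟨⟨p, a⟩, ⟨p', b⟩⟩ hx ⟨⟨q, c⟩, ⟨q', d⟩⟩ hy hxy
          simp only [Finset.coe_filter, Finset.mem_filter, Finset.mem_product, Set.mem_ofPred_eq, romP, Prod.mk.injEq, Finset.mem_range] at hx hy hxy
          obtain ⟨⟨-, h7⟩, rfl, rfl⟩ := hx
          obtain ⟨⟨-, h8⟩, rfl, rfl⟩ := hy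
          simp only [Prod.mk.injEq, and_true]
          omega
    refine (Finset.sum_le_sum hb).trans (le_of_eq ?_)
    rw [Finset.sum_add_distrib, Finset.sum_add_distrib, two_mul, ← add_assoc]
    congr 1
    · congr 1
      · rw [Finset.sum_product]
        simp only [Finset.sum_ite_eq, Finset.card_product]
        rw [Finset.sum_ite_mem, Finset.inter_self, Finset.sum_const, smul_eq_mul, mul_comm]
      · rw [Finset.sum_filter]
    · rw [Finset.sum_filter, Finset.sum_product, Finset.sum_comm, ← Finset.sum_product']
  · rintro ⟨⟨p, a⟩, ⟨p', b⟩⟩ hx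
    simp only [Finset.coe_filter, Finset.mem_filter, Finset.mem_product, Set.mem_ofPred_eq] at hx
    simp [hx.1.1.2, hx.1.2.2]

theorem rom_count (y : ℝ) (hy : 1 < y) (k0 : ℕ) :
    ∀ᶠ N : ℕ in atTop, Real.log 2 / (4 * Real.log y) * N
      ≤ ((romP N ×ˢ Finset.Icc k0 ⌊Real.log N / Real.log y⌋₊).card : ℝ) := by
  have hly : 0 < Real.log y := Real.log_pos hy
  have hl2 : 0 < Real.log 2 := Real.log_pos (by norm_num)
  have e1 : ∀ᶠ N : ℕ in atTop, Real.log N ≤ Real.log 2 / 4 * N := by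
    have := tendsto_natCast_atTop_atTop (R := ℝ) |>.eventually
      (Real.isLittleO_log_id_atTop.bound (show 0 < Real.log 2 / 4 by positivity))
    filter_upwards [this] with N hN
    simp only [id, Real.norm_eq_abs, Nat.abs_cast] at hN
    exact (le_abs_self _).trans hN
  have e2 : ∀ᶠ N : ℕ in atTop, 2 * k0 * Real.log y + 1 ≤ Real.log N :=
    (Real.tendsto_log_atTop.comp (tendsto_natCast_atTop_atTop (R := ℝ))).eventually_ge_atTop _
  filter_upwards [e1, e2, eventually_ge_atTop 4] with N h1 h2 h4
  have h4' : (4 : ℝ) ≤ N := by exact_mod_cast h4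
  have hlN : 0 < Real.log N := Real.log_pos (by linarith)
  have hpi : Real.log 2 * N / (2 * Real.log N) ≤ ((romP N).card : ℝ) := by
    have := Chebyshev.pi_ge N
    have e : (romP N).card = Nat.primeCounting N := by
      rw [Nat.primeCounting, Nat.primeCounting', Nat.count_eq_card_filter_range, romP]
    rw [e]
    refine le_trans ?_ this
    have : Real.log (N + 1) ≤ Real.log 2 + Real.log N := by
      rw [← Real.log_mul (by norm_num) (by linarith)]
      exact Real.log_le_log (by linarith) (by linarith)
    rw [div_le_div_iff₀ (by positivity) hlN]
    have h5 : Real.log 2 ≤ Real.log 2 / 4 * N := by nlinarith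
    have : Real.log 2 * N ≤ 2 * (N * Real.log 2 - Real.log (N + 1)) := by linarith
    nlinarith
  have hK : Real.log N / (2 * Real.log y) ≤ ((Finset.Icc k0 ⌊Real.log N / Real.log y⌋₊).card : ℝ) := by
    set K := ⌊Real.log N / Real.log y⌋₊ with hKd
    have hK1 : Real.log N / Real.log y < K + 1 := Nat.lt_floor_add_one _
    have hc : (K : ℝ) + 1 ≤ (Finset.Icc k0 K).card + k0 := by
      rw [Nat.card_Icc]
      have : K + 1 ≤ (K + 1 - k0) + k0 := by omega
      exact_mod_cast this
    have hk : (k0 : ℝ) ≤ Real.log N / (2 * Real.log y) := by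
      rw [le_div_iff₀ (by positivity)]; linarith
    have : Real.log N / Real.log y = 2 * (Real.log N / (2 * Real.log y)) := by field_simp
    linarith
  rw [Finset.card_product]
  push_cast
  calc Real.log 2 / (4 * Real.log y) * N
      = (Real.log 2 * N / (2 * Real.log N)) * (Real.log N / (2 * Real.log y)) := by
        field_simp; ring
    _ ≤ _ := by gcongr

theorem rom_floor (y : ℝ) (hy : 1 < y) (k : ℕ) : ⌊y ^ k⌋ = ((⌊y ^ k⌋₊ : ℕ) : ℤ) :=
  (Int.natCast_floor_eq_floor (by positivity)).symm

theorem rom_mono (y : ℝ) (hy : 1 < y) : ∃ k0 : ℕ, 1 ≤ k0 ∧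
    StrictMonoOn (fun k : ℕ => ⌊y ^ k⌋₊) (Set.Ici k0) := by
  obtain ⟨k1, hk1⟩ := ((tendsto_pow_atTop_atTop_of_one_lt hy).eventually_ge_atTop (1 / (y - 1))).exists
  refine ⟨k1 + 1, by omega, ?_⟩
  intro a ha b hb hab
  have ha' : k1 + 1 ≤ a := ha
  have hy1 : 0 < y - 1 := by linarith
  have h1 : 1 ≤ y ^ k1 * (y - 1) := (div_le_iff₀ hy1).1 hk1
  have h2 : y ^ k1 ≤ y ^ a := pow_le_pow_right₀ hy.le (by omega)
  have h3 : y ^ (a + 1) ≤ y ^ b := pow_le_pow_right₀ hy.le hab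
  have h4 : y ^ a + 1 ≤ y ^ b := by
    rw [pow_succ] at h3
    nlinarith
  have : ⌊y ^ a⌋₊ + 1 ≤ ⌊y ^ b⌋₊ := by
    rw [← Nat.floor_add_one (by positivity)]
    exact Nat.floor_le_floor h4
  exact this

theorem rom_main (y : ℝ) (hy : 1 < y) (C : ℝ) (hC : 0 < C)
    (h : ∀ N : ℕ, 2 ≤ N →
      ∑ kk ∈ (Finset.Icc 1 ⌊Real.log N / Real.log y⌋₊ ×ˢ
          Finset.Icc 1 ⌊Real.log N / Real.log y⌋₊).filter
            (fun kk => kk.1 < kk.2 ∧ ⌊y ^ kk.1⌋ < ⌊y ^ kk.2⌋),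
        ∏ p ∈ (⌊y ^ kk.2⌋ - ⌊y ^ kk.1⌋).toNat.primeFactors, (1 + 1 / (p : ℝ))
      ≤ C * Real.log N ^ 2) :
    ∃ c : ℝ, 0 < c ∧ ∀ᶠ N : ℕ in atTop,
      c * N ≤ (Nat.card {n : ℕ | n ∈ Sy y ∧ n ∈ Set.Icc 1 (2 * N)} : ℝ) := by
  have hly : 0 < Real.log y := Real.log_pos hy
  have hl2 : 0 < Real.log 2 := Real.log_pos (by norm_num)
  obtain ⟨k0, hk0, hmono⟩ := rom_mono y hy
  set c1 := Real.log 2 / (4 * Real.log y) with hc1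
  have hc1p : 0 < c1 := by positivity
  refine ⟨c1 ^ 2 / (c1 + 64000 * C), by positivity, ?_⟩
  filter_upwards [rom_count y hy k0, eventually_ge_atTop 2] with N hM hN
  have hN' : (2 : ℝ) ≤ N := by exact_mod_cast hN
  have hlN : 0 < Real.log N := Real.log_pos (by linarith)
  have hh := h N hN
  set K := ⌊Real.log N / Real.log y⌋₊ with hK
  set Ks := Finset.Icc k0 K with hKs
  set s := romP N ×ˢ Ks with hs
  let m : ℕ → ℕ := fun k => ⌊y ^ k⌋₊
  have hmon : StrictMonoOn m Ks := hmono.mono (by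
    intro k hk
    simp only [hKs, Finset.coe_Icc, Set.mem_Icc] at hk
    exact hk.1)
  have hE := rom_energy N Ks m hmon
  have hcs := rom_cs s (fun x => x.1 + m x.2)
  set B := s.image (fun x => x.1 + m x.2) with hB
  set E := ((s ×ˢ s).filter (fun x => x.1.1 + m x.1.2 = x.2.1 + m x.2.2)).card with hEd
  set T := ∑ kk ∈ (Ks ×ˢ Ks).filter (fun kk => kk.1 < kk.2), (romT (m kk.2 - m kk.1) N).card with hT
  have hTb : (T : ℝ) ≤ 32000 * C * N := by
    have h1 : (T : ℝ) * Real.log N ^ 2 ≤ (32000 * C * N) * Real.log N ^ 2 := by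
      calc (T : ℝ) * Real.log N ^ 2
          = ∑ kk ∈ (Ks ×ˢ Ks).filter (fun kk => kk.1 < kk.2),
              ((romT (m kk.2 - m kk.1) N).card : ℝ) * Real.log N ^ 2 := by
            rw [hT]; push_cast; rw [Finset.sum_mul]
        _ ≤ ∑ kk ∈ (Ks ×ˢ Ks).filter (fun kk => kk.1 < kk.2),
              32000 * N * ∏ p ∈ (⌊y ^ kk.2⌋ - ⌊y ^ kk.1⌋).toNat.primeFactors, (1 + 1 / (p : ℝ)) := by
            refine Finset.sum_le_sum fun kk hkk => ?_
            rw [Finset.mem_filter, Finset.mem_product] at hkk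
            have hlt : m kk.1 < m kk.2 := hmon hkk.1.1 hkk.1.2 hkk.2
            have e : (⌊y ^ kk.2⌋ - ⌊y ^ kk.1⌋).toNat = m kk.2 - m kk.1 := by
              rw [rom_floor y hy, rom_floor y hy]
              simp only [m] at hlt ⊢
              omega
            rw [e]
            exact rom_pairs _ N (by omega) hN
        _ = 32000 * N * ∑ kk ∈ (Ks ×ˢ Ks).filter (fun kk => kk.1 < kk.2),
              ∏ p ∈ (⌊y ^ kk.2⌋ - ⌊y ^ kk.1⌋).toNat.primeFactors, (1 + 1 / (p : ℝ)) := by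
            rw [Finset.mul_sum]
        _ ≤ 32000 * N * (C * Real.log N ^ 2) := by
            gcongr
            refine le_trans (Finset.sum_le_sum_of_subset_of_nonneg ?_ ?_) hh
            · intro kk hkk
              rw [Finset.mem_filter, Finset.mem_product] at hkk
              have hlt : m kk.1 < m kk.2 := hmon hkk.1.1 hkk.1.2 hkk.2
              simp only [hKs, Finset.mem_Icc] at hkk
              rw [Finset.mem_filter, Finset.mem_product, Finset.mem_Icc, Finset.mem_Icc,
                rom_floor y hy, rom_floor y hy]
              refine ⟨⟨⟨by omega, hkk.1.1.2⟩, by omega, hkk.1.2.2⟩, hkk.2, ?_⟩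
              exact_mod_cast hlt
            · intro kk _ _
              exact Finset.prod_nonneg fun _ _ => by positivity
        _ = _ := by ring
    exact le_of_mul_le_mul_right h1 (by positivity)
  have hEr : (E : ℝ) ≤ s.card + 64000 * C * N := by
    have : (E : ℝ) ≤ s.card + 2 * T := by exact_mod_cast hE
    linarith
  have hcsr : (s.card : ℝ) ^ 2 ≤ B.card * (s.card + 64000 * C * N) := by
    have : (s.card : ℝ) ^ 2 ≤ B.card * E := by exact_mod_cast hcs
    exact this.trans (by gcongr)
  have hBsub : B.card ≤ Nat.card {n : ℕ | n ∈ Sy y ∧ n ∈ Set.Icc 1 (2 * N)} := by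
    rw [Nat.card_coe_set_eq]
    have hfin : {n : ℕ | n ∈ Sy y ∧ n ∈ Set.Icc 1 (2 * N)}.Finite :=
      (Set.finite_Icc 1 (2 * N)).subset fun n hn => hn.2
    rw [← Set.ncard_coe_finset]
    refine Set.ncard_le_ncard ?_ hfin
    intro n hn
    rw [Finset.mem_coe, hB, Finset.mem_image] at hn
    obtain ⟨⟨p, k⟩, hx, rfl⟩ := hn
    simp only [hs, hKs, romP, Finset.mem_product, Finset.mem_filter, Finset.mem_range, Finset.mem_Icc] at hx
    obtain ⟨⟨hp1, hp2⟩, hk1, hk2⟩ := hx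
    have hmk : m k ≤ N := by
      have h1 : (k : ℝ) ≤ Real.log N / Real.log y :=
        (Nat.le_floor_iff (by positivity)).1 hk2
      rw [le_div_iff₀ hly, ← Real.log_pow] at h1
      have h2 : y ^ k ≤ N := (Real.log_le_log_iff (by positivity) (by linarith)).1 h1
      have := Nat.floor_le_floor h2
      rwa [Nat.floor_natCast] at this
    have := hp2.pos
    refine ⟨⟨p, k, hp2, by omega, ?_⟩, ?_⟩
    · rw [rom_floor y hy]; push_cast; rfl
    · simp only [Set.mem_Icc]; omega
  have hBsub' : (B.card : ℝ) ≤ Nat.card {n : ℕ | n ∈ Sy y ∧ n ∈ Set.Icc 1 (2 * N)} := by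
    exact_mod_cast hBsub
  refine le_trans ?_ hBsub'
  set M : ℝ := (s.card : ℝ) with hMd
  have hMpos : 0 < M := lt_of_lt_of_le (by positivity) hM
  have hpos : 0 < M + 64000 * C * N := by positivity
  refine le_of_mul_le_mul_right (le_trans ?_ hcsr) hpos
  rw [div_mul_eq_mul_div, div_mul_eq_mul_div, div_le_iff₀ (by positivity)]
  have a1 : c1 * (M + 64000 * C * N) ≤ M * (c1 + 64000 * C) := by nlinarith
  calc c1 ^ 2 * N * (M + 64000 * C * N) = c1 * N * (c1 * (M + 64000 * C * N)) := by ring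
    _ ≤ M * (M * (c1 + 64000 * C)) := by gcongr
    _ = _ := by ring

/-- If for some constant `C > 0` and all `N ≥ 2` one has
`Σ_{1 ≤ k₁ < k₂ ≤ log N / log y, ⌊y^{k₁}⌋ < ⌊y^{k₂}⌋}
  Π_{p prime, p ∣ ⌊y^{k₂}⌋ − ⌊y^{k₁}⌋} (1 + 1/p) ≤ C (log N)²`,
then the set `{p + ⌊y^k⌋ : p prime, k ≥ 1}` has positive lower asymptotic density. -/
theorem stmt1 (y : ℝ) (hy : 1 < y)
    (h : ∃ C : ℝ, 0 < C ∧ ∀ N : ℕ, 2 ≤ N →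
      ∑ kk ∈ (Finset.Icc 1 ⌊Real.log N / Real.log y⌋₊ ×ˢ
          Finset.Icc 1 ⌊Real.log N / Real.log y⌋₊).filter
            (fun kk => kk.1 < kk.2 ∧ ⌊y ^ kk.1⌋ < ⌊y ^ kk.2⌋),
        ∏ p ∈ (⌊y ^ kk.2⌋ - ⌊y ^ kk.1⌋).toNat.primeFactors, (1 + 1 / (p : ℝ))
      ≤ C * Real.log N ^ 2) :
    0 < delta y := by
  obtain ⟨C, hC, h⟩ := h
  obtain ⟨c, hc, hev⟩ := rom_main y hy C hC h
  have hfin : ∀ N : ℕ, {n : ℕ | n ∈ Sy y ∧ n ∈ Set.Icc 1 N}.Finite := fun N =>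
    (Set.finite_Icc 1 N).subset fun n hn => hn.2
  refine lt_of_lt_of_le (show 0 < c / 3 by positivity) ?_
  refine le_liminf_of_le ?_ ?_
  · refine IsBoundedUnder.isCoboundedUnder_ge ⟨1, ?_⟩
    rw [eventually_map]
    refine Eventually.of_forall fun N => ?_
    refine div_le_one_of_le₀ ?_ (by positivity)
    rw [Nat.card_coe_set_eq]
    have : {n : ℕ | n ∈ Sy y ∧ n ∈ Set.Icc 1 N}.ncard ≤ (Set.Icc 1 N).ncard :=
      Set.ncard_le_ncard (fun n hn => hn.2) (Set.finite_Icc 1 N)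
    have h2 : (Set.Icc 1 N).ncard = N := by
      rw [← Finset.coe_Icc, Set.ncard_coe_finset, Nat.card_Icc]; omega
    rw [h2] at this
    exact_mod_cast this
  · have hdiv : Tendsto (fun N : ℕ => N / 2) atTop atTop :=
      Nat.tendsto_div_const_atTop (by norm_num)
    filter_upwards [hdiv.eventually hev, eventually_ge_atTop 3] with N h1 h3
    have h3' : (3 : ℝ) ≤ N := by exact_mod_cast h3
    rw [le_div_iff₀ (by linarith)]
    have h4 : (N : ℝ) / 3 ≤ ((N / 2 : ℕ) : ℝ) := by
      have : N ≤ 3 * (N / 2) := by omega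
      have : (N : ℝ) ≤ 3 * ((N / 2 : ℕ) : ℝ) := by exact_mod_cast this
      linarith
    have h5 : (Nat.card {n : ℕ | n ∈ Sy y ∧ n ∈ Set.Icc 1 (2 * (N / 2))} : ℝ)
        ≤ Nat.card {n : ℕ | n ∈ Sy y ∧ n ∈ Set.Icc 1 N} := by
      have : Nat.card {n : ℕ | n ∈ Sy y ∧ n ∈ Set.Icc 1 (2 * (N / 2))}
        ≤ Nat.card {n : ℕ | n ∈ Sy y ∧ n ∈ Set.Icc 1 N} := by
        rw [Nat.card_coe_set_eq, Nat.card_coe_set_eq]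
        refine Set.ncard_le_ncard ?_ (hfin N)
        rintro n ⟨hn, hn1, hn2⟩
        exact ⟨hn, hn1, by omega⟩
      exact_mod_cast this
    calc c / 3 * N = c * (N / 3) := by ring
      _ ≤ c * ((N / 2 : ℕ) : ℝ) := by gcongr
      _ ≤ _ := h1.trans h5
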